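/- (Two independent replica profiles give comparable values.) Let T be a measurable space, μ a probability measure on T, m ≥ 2, δ > 0, η ∈ (0,1), and w : T × {1,…,m} → [0,1] measurable. Let R = (R_1,…,R_{km}) and R' = (R'_1,…,R'_{km}) be two independent profiles, each consisting of km i.i.d. draws from μ, and let V(R), V(R') be the corresponding weight matrices with entries w(R_i, j) and w(R'_i, j). If k ≥ 32·log(8/η) / (δ²·m·(log m)²), then with probability at least 1 − η/2, (1/2)·OPT_δ(V(R)) ≤ OPT_δ(V(R')) ≤ (3/2)·OPT_δ(V(R)). -/

import Mathlib

open MeasureTheory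
open scoped ENNReal

/-- The entropy-regularized matching value `OPT_δ(v)`: the supremum over fractional `k`-to-`1`
assignments `x ≥ 0` (row sums at most `1` over the `km` replicas, column sums at most `k` over
the `m` surrogates) of `∑_{i,j} x_{ij} v_{ij} - δ ∑_{i,j} x_{ij} log x_{ij}`.  The convention
`0·log 0 = 0` holds automatically since `Real.log 0 = 0`. -/
noncomputable def OPTreg (m k : ℕ) (δ : ℝ) (v : Fin (k * m) → Fin m → ℝ) : ℝ :=
  sSup {val : ℝ | ∃ x : Fin (k * m) → Fin m → ℝ,
    (∀ i j, 0 ≤ x i j) ∧ (∀ i, ∑ j, x i j ≤ 1) ∧ (∀ j, ∑ i, x i j ≤ (k : ℝ)) ∧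
    val = ∑ i, ∑ j, (x i j * v i j - δ * (x i j * Real.log (x i j)))}

open ProbabilityTheory in
/-- A bounded function on a product is sub-Gaussian about its mean as soon as its slices are, and
so is the function of slice means. -/
theorem hasSubgaussianMGF_prod {S Ω : Type*} [MeasurableSpace S] [MeasurableSpace Ω]
    {μ : Measure S} [IsProbabilityMeasure μ] {ν : Measure Ω} [IsProbabilityMeasure ν]
    {H : S × Ω → ℝ} (hH : Measurable H) {l u : ℝ} (hb : ∀ p, H p ∈ Set.Icc l u) {a b : NNReal}
    (hslice : ∀ y, HasSubgaussianMGF (fun x => H (x, y) - ∫ x, H (x, y) ∂μ) a μ)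
    (hmean : HasSubgaussianMGF
      (fun y => (∫ x, H (x, y) ∂μ) - ∫ y, ∫ x, H (x, y) ∂μ ∂ν) b ν) :
    HasSubgaussianMGF (fun p => H p - ∫ p, H p ∂(μ.prod ν)) (a + b) (μ.prod ν) := by
  have hHint : Integrable H (μ.prod ν) :=
    Integrable.of_mem_Icc l u hH.aemeasurable (Filter.Eventually.of_forall hb)
  have hswap : ∫ p, H p ∂(μ.prod ν) = ∫ y, ∫ x, H (x, y) ∂μ ∂ν := integral_prod_symm H hHint
  set c := ∫ p, H p ∂(μ.prod ν) with hc
  rw [← hswap] at hmean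
  have hint : ∀ t : ℝ, Integrable (fun p => Real.exp (t * (H p - c))) (μ.prod ν) := fun t =>
    integrable_exp_mul_of_mem_Icc (a := l - c) (b := u - c) (hH.sub_const c).aemeasurable
      (Filter.Eventually.of_forall fun p =>
        ⟨sub_le_sub_right (hb p).1 c, sub_le_sub_right (hb p).2 c⟩)
  refine ⟨hint, fun t => ?_⟩
  have hle : ∀ y, ∫ x, Real.exp (t * (H (x, y) - c)) ∂μ
      ≤ Real.exp (t * ((∫ x, H (x, y) ∂μ) - c)) * Real.exp (a * t ^ 2 / 2) := by
    intro y
    calc ∫ x, Real.exp (t * (H (x, y) - c)) ∂μ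
        = ∫ x, Real.exp (t * ((∫ x, H (x, y) ∂μ) - c))
            * Real.exp (t * (H (x, y) - ∫ x, H (x, y) ∂μ)) ∂μ := by
          congr 1 with x
          rw [← Real.exp_add]
          ring_nf
      _ = Real.exp (t * ((∫ x, H (x, y) ∂μ) - c))
            * mgf (fun x => H (x, y) - ∫ x, H (x, y) ∂μ) μ t := by
          rw [integral_const_mul, mgf]
      _ ≤ _ := by
          gcongr
          exact (hslice y).mgf_le t
  calc mgf (fun p => H p - c) (μ.prod ν) t
      = ∫ y, ∫ x, Real.exp (t * (H (x, y) - c)) ∂μ ∂ν := integral_prod_symm _ (hint t)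
    _ ≤ ∫ y, Real.exp (t * ((∫ x, H (x, y) ∂μ) - c)) * Real.exp (a * t ^ 2 / 2) ∂ν :=
        integral_mono (hint t).integral_prod_right ((hmean.integrable_exp_mul t).mul_const _) hle
    _ = mgf (fun y => (∫ x, H (x, y) ∂μ) - c) ν t * Real.exp (a * t ^ 2 / 2) := by
        rw [integral_mul_const, mgf]
    _ ≤ Real.exp (b * t ^ 2 / 2) * Real.exp (a * t ^ 2 / 2) := by
        gcongr
        exact hmean.mgf_le t
    _ = Real.exp ((a + b : NNReal) * t ^ 2 / 2) := by
        rw [← Real.exp_add, NNReal.coe_add]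
        ring_nf

theorem abs_sub_le_sum_of_bounded_differences {T : Type*} {n : ℕ} {G : (Fin n → T) → ℝ}
    {c : Fin n → NNReal} (hc : ∀ R i t, |G (Function.update R i t) - G R| ≤ c i)
    (R R' : Fin n → T) : |G R - G R'| ≤ ∑ i, (c i : ℝ) := by
  induction n with
  | zero => simp [Subsingleton.elim R R']
  | succ n ih =>
    obtain ⟨r, R, rfl⟩ : ∃ r ρ, R = Fin.cons r ρ := ⟨_, _, (Fin.cons_self_tail R).symm⟩
    obtain ⟨r', R', rfl⟩ : ∃ r ρ, R' = Fin.cons r ρ := ⟨_, _, (Fin.cons_self_tail R').symm⟩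
    have h0 := hc (Fin.cons r' R) 0 r
    rw [Fin.update_cons_zero] at h0
    have h1 := ih (G := fun ρ => G (Fin.cons r' ρ)) (c := fun i => c i.succ)
      (fun ρ i t => by simpa only [Fin.cons_update] using hc (Fin.cons r' ρ) i.succ t) R R'
    rw [Fin.sum_univ_succ]
    exact (abs_sub_le _ (G (Fin.cons r' R)) _).trans (add_le_add h0 h1)

open ProbabilityTheory in
/-- **McDiarmid's inequality**, as a bound on the moment generating function: a function of i.i.d.
samples with bounded differences `c i` is sub-Gaussian about its mean. -/
theorem hasSubgaussianMGF_of_bounded_differences {T : Type*} [MeasurableSpace T] (μ : Measure T)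
    [IsProbabilityMeasure μ] {n : ℕ} {G : (Fin n → T) → ℝ} (hG : Measurable G)
    {c : Fin n → NNReal} (hc : ∀ R i t, |G (Function.update R i t) - G R| ≤ c i) :
    HasSubgaussianMGF (fun R => G R - ∫ R, G R ∂(Measure.pi fun _ => μ)) (∑ i, (c i / 2) ^ 2)
      (Measure.pi fun _ => μ) := by
  have : Nonempty T := nonempty_of_isProbabilityMeasure μ
  induction n with
  | zero =>
    have hconst : ∀ R, G R = G default := fun R => congrArg G (Subsingleton.elim _ _)
    simp [hconst]
  | succ n ih =>
    let H : T × (Fin n → T) → ℝ := fun p => G (Fin.cons p.1 p.2)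
    have hcons := measurePreserving_piFinSuccAbove (fun _ : Fin (n + 1) => μ) 0
    have hH : Measurable H := by
      simpa [Function.comp_def, MeasurableEquiv.piFinSuccAbove, H] using!
        hG.comp (MeasurableEquiv.piFinSuccAbove (fun _ : Fin (n + 1) => T) 0).symm.measurable
    have hcomp : ∀ R, H (MeasurableEquiv.piFinSuccAbove (fun _ => T) 0 R) = G R := fun R =>
      congrArg G (Fin.cons_self_tail R)
    have hfst : ∀ x x' y, H (x, y) - H (x', y) ≤ c 0 := fun x x' y => by
      have h0 := hc (Fin.cons x' y) 0 x
      rw [Fin.update_cons_zero] at h0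
      exact (le_abs_self _).trans h0
    have hsnd : ∀ x y i t, |H (x, Function.update y i t) - H (x, y)| ≤ c i.succ :=
      fun x y i t => by
        simpa only [H, Fin.cons_update] using hc (Fin.cons x y) i.succ t
    obtain ⟨l, u, hb⟩ : ∃ l u, ∀ p, H p ∈ Set.Icc l u := by
      let R₀ : Fin (n + 1) → T := fun _ => Classical.arbitrary T
      refine ⟨G R₀ - ∑ i, (c i : ℝ), G R₀ + ∑ i, (c i : ℝ), fun p => ?_⟩
      have h := abs_le.1 (abs_sub_le_sum_of_bounded_differences hc (Fin.cons p.1 p.2) R₀)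
      constructor <;> dsimp only [H] <;> linarith [h.1, h.2]
    have hHy : ∀ y, Measurable fun x => H (x, y) := fun y => hH.comp measurable_prodMk_right
    have hHint : ∀ y, Integrable (fun x => H (x, y)) μ := fun y =>
      Integrable.of_mem_Icc l u (hHy y).aemeasurable (Filter.Eventually.of_forall fun x => hb _)
    have key := hasSubgaussianMGF_prod (μ := μ) (ν := Measure.pi fun _ => μ) hH hb
      (a := (c 0 / 2) ^ 2) (b := ∑ i : Fin n, (c i.succ / 2) ^ 2) (fun y => ?_)
      (ih (G := fun y => ∫ x, H (x, y) ∂μ) ?_ fun y i t => ?_)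
    · have hmean : ∫ p, H p ∂(μ.prod (Measure.pi fun _ : Fin n => μ))
          = ∫ R, G R ∂(Measure.pi fun _ : Fin (n + 1) => μ) := by
        rw [← hcons.integral_comp' (g := H)]
        simp only [hcomp]
      rw [hmean, ← Fin.sum_univ_succ fun i => (c i / 2) ^ 2, ← hcons.map_eq] at key
      simpa only [Function.comp_def, hcomp] using
        HasSubgaussianMGF.of_map hcons.measurable.aemeasurable key
    · have hbdd : BddBelow (Set.range fun x => H (x, y)) :=
        ⟨l, Set.forall_mem_range.2 fun x => (hb _).1⟩
      have h := hasSubgaussianMGF_of_mem_Icc (μ := μ) (a := ⨅ x, H (x, y))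
        (b := (⨅ x, H (x, y)) + c 0) (hHy y).aemeasurable
        (Filter.Eventually.of_forall fun x => ⟨ciInf_le hbdd x, ?_⟩)
      · simpa using h
      · rw [← sub_le_iff_le_add]
        exact le_ciInf fun x' => by linarith [hfst x x' y]
    · exact (StronglyMeasurable.integral_prod_left (μ := μ) (f := fun x y => H (x, y))
        hH.stronglyMeasurable).measurable
    · rw [← integral_sub (hHint _) (hHint _)]
      simpa using norm_integral_le_of_norm_le_const (μ := μ) (C := c i.succ)
        (f := fun x => H (x, Function.update y i t) - H (x, y))
        (Filter.Eventually.of_forall fun x => hsnd x y i t)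

theorem le_one_of_row_sum_le_one {ι κ : Type*} [Fintype κ] {x : ι → κ → ℝ}
    (h0 : ∀ i j, 0 ≤ x i j) (h1 : ∀ i, ∑ j, x i j ≤ 1) (i : ι) (j : κ) : x i j ≤ 1 :=
  (Finset.single_le_sum (fun j _ => h0 i j) (Finset.mem_univ j)).trans (h1 i)

theorem bddAbove_OPTreg (m k : ℕ) {δ : ℝ} (hδ : 0 ≤ δ) (v : Fin (k * m) → Fin m → ℝ) :
    BddAbove {val : ℝ | ∃ x : Fin (k * m) → Fin m → ℝ,
      (∀ i j, 0 ≤ x i j) ∧ (∀ i, ∑ j, x i j ≤ 1) ∧ (∀ j, ∑ i, x i j ≤ (k : ℝ)) ∧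
      val = ∑ i, ∑ j, (x i j * v i j - δ * (x i j * Real.log (x i j)))} := by
  refine ⟨∑ i, ∑ j, (|v i j| + δ), ?_⟩
  rintro _ ⟨x, h0, h1, -, rfl⟩
  refine Finset.sum_le_sum fun i _ => Finset.sum_le_sum fun j _ => ?_
  have hx := h0 i j
  have h_log := Real.self_sub_one_le_mul_log hx
  have hv : x i j * v i j ≤ |v i j| :=
    (mul_le_mul_of_nonneg_left (le_abs_self _) hx).trans
      (mul_le_of_le_one_left (abs_nonneg _) (le_one_of_row_sum_le_one h0 h1 i j))
  nlinarith

theorem le_OPTreg {m k : ℕ} {δ : ℝ} (hδ : 0 ≤ δ) (v : Fin (k * m) → Fin m → ℝ)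
    {x : Fin (k * m) → Fin m → ℝ} (h0 : ∀ i j, 0 ≤ x i j) (h1 : ∀ i, ∑ j, x i j ≤ 1)
    (hk : ∀ j, ∑ i, x i j ≤ (k : ℝ)) :
    ∑ i, ∑ j, (x i j * v i j - δ * (x i j * Real.log (x i j))) ≤ OPTreg m k δ v :=
  le_csSup (bddAbove_OPTreg m k hδ v) ⟨x, h0, h1, hk, rfl⟩

theorem OPTreg_le_add_sum {m k : ℕ} {δ : ℝ} (hδ : 0 ≤ δ) {v v' : Fin (k * m) → Fin m → ℝ}
    {d : Fin (k * m) → ℝ} (hd : ∀ i, 0 ≤ d i) (hv : ∀ i j, v i j ≤ v' i j + d i) :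
    OPTreg m k δ v ≤ OPTreg m k δ v' + ∑ i, d i := by
  refine csSup_le ⟨_, 0, by simp, by simp, by simp, rfl⟩ ?_
  rintro _ ⟨x, h0, h1, hk, rfl⟩
  refine le_trans ?_ (add_le_add_left (le_OPTreg hδ v' h0 h1 hk) _)
  rw [← Finset.sum_add_distrib]
  refine Finset.sum_le_sum fun i _ => ?_
  calc ∑ j, (x i j * v i j - δ * (x i j * Real.log (x i j)))
      ≤ ∑ j, (x i j * v' i j - δ * (x i j * Real.log (x i j)) + x i j * d i) :=
        Finset.sum_le_sum fun j _ => by nlinarith [mul_le_mul_of_nonneg_left (hv i j) (h0 i j)]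
    _ = ∑ j, (x i j * v' i j - δ * (x i j * Real.log (x i j))) + (∑ j, x i j) * d i := by
        rw [Finset.sum_add_distrib, Finset.sum_mul]
    _ ≤ _ := by
        gcongr
        exact mul_le_of_le_one_left (hd i) (h1 i)

theorem continuous_OPTreg (m k : ℕ) {δ : ℝ} (hδ : 0 ≤ δ) : Continuous (OPTreg m k δ) := by
  refine (LipschitzWith.of_le_add_mul ((k * m : ℕ) : NNReal) fun v v' => ?_).continuous
  have h := OPTreg_le_add_sum hδ (v := v) (v' := v') (d := fun _ => dist v v')
    (fun _ => dist_nonneg) fun i j => by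
      have h1 := (dist_le_pi_dist (v i) (v' i) j).trans (dist_le_pi_dist v v' i)
      rw [Real.dist_eq] at h1
      linarith [le_abs_self (v i j - v' i j)]
  simpa using h

/-- The uniform assignment bounds the matching value below by its entropy. -/
theorem entropy_le_OPTreg {m k : ℕ} (hm : m ≠ 0) {δ : ℝ} (hδ : 0 ≤ δ)
    {v : Fin (k * m) → Fin m → ℝ} (hv : ∀ i j, 0 ≤ v i j) :
    δ * (k * m * Real.log m) ≤ OPTreg m k δ v := by
  have hm' : (m : ℝ) ≠ 0 := Nat.cast_ne_zero.2 hm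
  refine le_trans ?_ (le_OPTreg hδ v (x := fun _ _ => (m : ℝ)⁻¹) (fun _ _ => by positivity)
    (fun _ => by simp [hm']) fun _ => by simp [hm'])
  calc δ * (k * m * Real.log m)
      = ∑ _i : Fin (k * m), ∑ _j : Fin m, -(δ * ((m : ℝ)⁻¹ * Real.log (m : ℝ)⁻¹)) := by
        simp only [Finset.sum_const, Finset.card_univ, Fintype.card_fin, nsmul_eq_mul,
          Real.log_inv, Nat.cast_mul]
        field_simp
    _ ≤ _ := Finset.sum_le_sum fun i _ => Finset.sum_le_sum fun j _ => by
        have := mul_nonneg (inv_nonneg.2 (Nat.cast_nonneg (α := ℝ) m)) (hv i j)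
        linarith

theorem abs_OPTreg_update_sub_le {T : Type*} {m k : ℕ} {δ : ℝ} (hδ : 0 ≤ δ) {w : T → Fin m → ℝ}
    (hw : ∀ t j, w t j ∈ Set.Icc (0 : ℝ) 1) (R : Fin (k * m) → T) (i : Fin (k * m)) (t : T) :
    |OPTreg m k δ (fun l j => w (Function.update R i t l) j)
      - OPTreg m k δ (fun l j => w (R l) j)| ≤ 1 := by
  have hsum : ∑ l, (Pi.single i 1 : Fin (k * m) → ℝ) l = 1 := by simp
  have hd : ∀ l, 0 ≤ (Pi.single i 1 : Fin (k * m) → ℝ) l :=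
    fun l => by
    simp only [Pi.single_apply]
    split <;> simp
  have hle : ∀ l j, |w (Function.update R i t l) j - w (R l) j|
      ≤ (Pi.single i 1 : Fin (k * m) → ℝ) l := by
    intro l j
    rcases eq_or_ne i l with rfl | hl
    · rw [Pi.single_eq_same]
      have h0 := hw (Function.update R i t i) j
      have h1 := hw (R i) j
      exact abs_le.2 ⟨by linarith [h0.1, h1.2], by linarith [h0.2, h1.1]⟩
    · simp [hl.symm]
  rw [abs_sub_le_iff]
  constructor
  · have := OPTreg_le_add_sum (m := m) hδ (v := fun l j => w (Function.update R i t l) j)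
      (v' := fun l j => w (R l) j) hd fun l j => by linarith [(abs_le.1 (hle l j)).2]
    linarith
  · have := OPTreg_le_add_sum (m := m) hδ (v' := fun l j => w (Function.update R i t l) j)
      (v := fun l j => w (R l) j) hd fun l j => by linarith [(abs_le.1 (hle l j)).1]
    linarith

open ProbabilityTheory in
/-- Two independent samples of a bounded-differences statistic are within `s` of each other up to
a sub-Gaussian tail. -/
theorem measureReal_abs_sub_ge_le_of_bounded_differences {T : Type*} [MeasurableSpace T]
    (μ : Measure T) [IsProbabilityMeasure μ] {n : ℕ} {G : (Fin n → T) → ℝ} (hG : Measurable G)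
    {c : Fin n → NNReal} (hc : ∀ R i t, |G (Function.update R i t) - G R| ≤ c i)
    {s : ℝ} (hs : 0 ≤ s) :
    ((Measure.pi fun _ : Fin n => μ).prod (Measure.pi fun _ : Fin n => μ)).real
      {p | s ≤ |G p.1 - G p.2|} ≤ 2 * Real.exp (-s ^ 2 / ∑ i, (c i : ℝ) ^ 2) := by
  set ν := Measure.pi fun _ : Fin n => μ
  have hsub := hasSubgaussianMGF_of_bounded_differences μ hG hc
  have h1 := HasSubgaussianMGF.of_map (μ := ν.prod ν) (Y := Prod.fst) measurable_fst.aemeasurable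
    (by rw [measurePreserving_fst.map_eq]; exact hsub)
  have h2 := HasSubgaussianMGF.of_map (μ := ν.prod ν) (Y := Prod.snd) measurable_snd.aemeasurable
    (by rw [measurePreserving_snd.map_eq]; exact hsub)
  have hdiff := h1.sub_of_indepFun h2
    (indepFun_prod (hG.sub_const (∫ R, G R ∂ν)) (hG.sub_const (∫ R, G R ∂ν)))
  simp only [Function.comp_def, sub_sub_sub_cancel_right] at hdiff
  have hconst : (2 : ℝ) * ((∑ i, (c i / 2) ^ 2 + ∑ i, (c i / 2) ^ 2 : NNReal) : ℝ)
      = ∑ i, (c i : ℝ) ^ 2 := by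
    push_cast
    simp only [div_pow, ← Finset.sum_div]
    ring
  have hpos := hdiff.measure_ge_le hs
  have hneg := hdiff.neg.measure_ge_le hs
  rw [hconst] at hpos hneg
  have hsubset : {p : (Fin n → T) × (Fin n → T) | s ≤ |G p.1 - G p.2|}
      ⊆ {p | s ≤ G p.1 - G p.2} ∪ {p | s ≤ (-fun p => G p.1 - G p.2) p} :=
    fun p hp => by
    rcases (le_abs.1 hp : s ≤ G p.1 - G p.2 ∨ s ≤ -(G p.1 - G p.2)) with h | h
    · exact Or.inl h
    · exact Or.inr h
  calc _ ≤ _ := measureReal_mono hsubset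
    _ ≤ _ := measureReal_union_le _ _
    _ ≤ _ := by linarith

/-- **Two independent replica profiles give comparable values.** Let `R` and `R'` be two
independent profiles of `km` i.i.d. draws from `μ`, with weight matrices `V(R)_{ij} = w(R_i,j)`
and `V(R')_{ij} = w(R'_i,j)`.  If `k ≥ 32·log(8/η)/(δ²·m·(log m)²)` then with probability at
least `1 - η/2`, `(1/2)·OPT_δ(V(R)) ≤ OPT_δ(V(R')) ≤ (3/2)·OPT_δ(V(R))`. -/
theorem OPTreg_two_profiles_comparable
    {T : Type*} [MeasurableSpace T] (μ : Measure T) [IsProbabilityMeasure μ]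
    (m k : ℕ) (hm : 2 ≤ m) (hk : 1 ≤ k)
    (δ η : ℝ) (hδ : 0 < δ) (hη : η ∈ Set.Ioo (0 : ℝ) 1)
    (w : T → Fin m → ℝ) (hw : ∀ j, Measurable fun t => w t j)
    (hwr : ∀ t j, w t j ∈ Set.Icc (0 : ℝ) 1)
    (hkbig : (k : ℝ) ≥ 32 * Real.log (8 / η) / (δ ^ 2 * m * (Real.log m) ^ 2)) :
    ((Measure.pi fun _ : Fin (k * m) => μ).prod (Measure.pi fun _ : Fin (k * m) => μ))
      {p | (1 / 2) * OPTreg m k δ (fun i j => w (p.1 i) j)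
            ≤ OPTreg m k δ (fun i j => w (p.2 i) j)
         ∧ OPTreg m k δ (fun i j => w (p.2 i) j)
            ≤ (3 / 2) * OPTreg m k δ (fun i j => w (p.1 i) j)}
      ≥ 1 - ENNReal.ofReal (η / 2) := by
  have hη0 := hη.1
  have h8 : 1 < 8 / η := by rw [lt_div_iff₀ hη0]; linarith [hη.2]
  have hm1 : (1 : ℝ) < m := by exact_mod_cast hm
  have hk0 : (0 : ℝ) < k := by exact_mod_cast hk
  have hlogm := Real.log_pos hm1
  set G : (Fin (k * m) → T) → ℝ := fun R => OPTreg m k δ fun i j => w (R i) j with hGdef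
  set E : ℝ := δ * (k * m * Real.log m) with hE
  have hE0 : 0 < E := by positivity
  have hGE : ∀ R, E ≤ G R := fun R =>
    entropy_le_OPTreg (by omega) hδ.le fun i j => (hwr (R i) j).1
  have hG : Measurable G := (continuous_OPTreg m k hδ.le).measurable.comp <|
    measurable_pi_lambda _ fun i => measurable_pi_lambda _ fun j =>
      (hw j).comp (measurable_pi_apply i)
  set P := (Measure.pi fun _ : Fin (k * m) => μ).prod (Measure.pi fun _ : Fin (k * m) => μ)
  have htail : P.real {p | E / 2 ≤ |G p.1 - G p.2|} ≤ η / 2 := by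
    refine (measureReal_abs_sub_ge_le_of_bounded_differences μ hG (c := fun _ => 1)
      (by simpa using! abs_OPTreg_update_sub_le hδ.le hwr) (half_pos hE0).le).trans ?_
    have h_exp : Real.log (8 / η) ≤ (E / 2) ^ 2 / (k * m) := by
      rw [ge_iff_le, div_le_iff₀ (by positivity)] at hkbig
      have h : (E / 2) ^ 2 / (k * m) = k * (δ ^ 2 * m * Real.log m ^ 2) / 4 := by
        rw [hE]
        field_simp
        ring
      rw [h]
      linarith [Real.log_pos h8]
    have hη8 : Real.exp (-Real.log (8 / η)) = η / 8 := by
      rw [Real.exp_neg, Real.exp_log (by positivity), inv_div]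
    have h := Real.exp_le_exp.2 (neg_le_neg h_exp)
    rw [hη8] at h
    simp only [NNReal.coe_one, one_pow, Finset.sum_const, Finset.card_univ, Fintype.card_fin,
      nsmul_eq_mul, mul_one, Nat.cast_mul, neg_div]
    linarith
  set A := {p : (Fin (k * m) → T) × (Fin (k * m) → T) |
    (1 / 2) * G p.1 ≤ G p.2 ∧ G p.2 ≤ (3 / 2) * G p.1}
  have hcompl : Aᶜ ⊆ {p | E / 2 ≤ |G p.1 - G p.2|} := by
    intro p hp
    by_contra hlt
    have h := abs_lt.1 (lt_of_not_ge hlt : |G p.1 - G p.2| < E / 2)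
    have hge := hGE p.1
    exact hp ⟨by linarith [h.2], by linarith [h.1]⟩
  have hP : P Aᶜ ≤ ENNReal.ofReal (η / 2) :=
    (ENNReal.le_ofReal_iff_toReal_le (measure_ne_top _ _) (by positivity)).2
      ((measureReal_mono hcompl).trans htail)
  refine tsub_le_iff_right.2 ?_
  calc (1 : ℝ≥0∞) = P Set.univ := measure_univ.symm
    _ ≤ P A + P Aᶜ := by rw [← Set.union_compl_self A]; exact measure_union_le _ _
    _ ≤ _ := by gcongr
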